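/- Let p and q be probability measures on a measurable space Ω with q absolutely continuous with respect to p, and let l : Ω → ℝ be σ-sub-Gaussian under p and q-integrable. Then |E_q[l] − E_p[l]| ≤ σ √(2 KL(q‖p)). -/

import Mathlib

open MeasureTheory Real ENNReal
open scoped Classical

/-- The Kullback–Leibler divergence `KL(q‖p)`, equal to `∫ log (dq/dp) dq` when `q` is
absolutely continuous with respect to `p` (and the integral is well defined),
and `+∞` otherwise. -/
noncomputable def klDiv {Ω : Type*} [MeasurableSpace Ω] (q p : Measure Ω) : ℝ≥0∞ :=
  if q ≪ p ∧ Integrable (llr q p) q then ENNReal.ofReal (∫ x, llr q p x ∂q) else ⊤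

/-- A function `l : Ω → ℝ` is `σ`-sub-Gaussian under a probability measure `p` if it is
`p`-integrable and for all `λ ∈ ℝ`, `log E_p[exp (λ (l − E_p[l]))] ≤ λ²σ²/2`
(the moment generating function being well defined). -/
def IsSubGaussian {Ω : Type*} [MeasurableSpace Ω] (p : Measure Ω) (σ : ℝ) (l : Ω → ℝ) : Prop :=
  0 ≤ σ ∧ Integrable l p ∧ ∀ lam : ℝ,
    Integrable (fun x => Real.exp (lam * (l x - ∫ y, l y ∂p))) p ∧
    Real.log (∫ x, Real.exp (lam * (l x - ∫ y, l y ∂p)) ∂p) ≤ lam ^ 2 * σ ^ 2 / 2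

theorem subGaussian_zero_ae {Ω : Type*} [MeasurableSpace Ω]
    (p : Measure Ω) [IsProbabilityMeasure p] (l : Ω → ℝ)
    (hsg : IsSubGaussian p 0 l) : ∀ᵐ x ∂p, l x = ∫ y, l y ∂p := by
  obtain ⟨-, hl, h⟩ := hsg
  obtain ⟨hi, hle⟩ := h 1
  simp only [one_mul] at hi hle
  set m := ∫ y, l y ∂p with hm
  have hpos : 0 < ∫ x, Real.exp (l x - m) ∂p := integral_exp_pos hi
  have hle1 : ∫ x, Real.exp (l x - m) ∂p ≤ 1 := by
    rw [← Real.log_nonpos_iff hpos.le]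
    simpa using hle
  have hX : Integrable (fun x => l x - m) p := hl.sub (integrable_const _)
  have hX1 : Integrable (fun x => (l x - m) + 1) p := hX.add (integrable_const _)
  have hX0 : ∫ x, ((l x - m) + 1) ∂p = 1 := by
    rw [integral_add hX (integrable_const _), integral_sub hl (integrable_const _)]
    simp [hm]
  have hnn : 0 ≤ fun x => Real.exp (l x - m) - ((l x - m) + 1) := fun x =>
    sub_nonneg.2 (Real.add_one_le_exp _)
  have hz : ∫ x, (Real.exp (l x - m) - ((l x - m) + 1)) ∂p = 0 := by
    apply le_antisymm
    · rw [integral_sub hi hX1, hX0]; linarith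
    · exact integral_nonneg hnn
  rw [integral_eq_zero_iff_of_nonneg hnn (hi.sub hX1)] at hz
  filter_upwards [hz] with x hx
  by_contra hne
  have := Real.add_one_lt_exp (sub_ne_zero.2 hne)
  simp only [Pi.zero_apply] at hx
  linarith

theorem dv_bound {Ω : Type*} [MeasurableSpace Ω]
    (p q : Measure Ω) [IsProbabilityMeasure p] [IsProbabilityMeasure q]
    (f : Ω → ℝ) (hac : q ≪ p) (hfq : Integrable f q)
    (hfp : Integrable (fun x => Real.exp (f x)) p) (hi : Integrable (llr q p) q) :
    ∫ x, f x ∂q ≤ ∫ x, llr q p x ∂q + Real.log (∫ x, Real.exp (f x) ∂p) := by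
  have hac' : q ≪ p.tilted f := hac.trans (absolutelyContinuous_tilted hfp)
  have := isProbabilityMeasure_tilted hfp
  have h := InformationTheory.integral_llr_add_sub_measure_univ_nonneg hac'
    (integrable_llr_tilted_right hac hfq hi hfp)
  rw [integral_llr_tilted_right hac hfq hfp hi] at h
  simp at h
  linarith

/-- If `q ≪ p` are probability measures and `l` is `σ`-sub-Gaussian under `p` and
`q`-integrable, then `|E_q[l] − E_p[l]| ≤ σ √(2 KL(q‖p))`. -/
theorem abs_integral_sub_le_sqrt_klDiv {Ω : Type*} [MeasurableSpace Ω]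
    (p q : Measure Ω) [IsProbabilityMeasure p] [IsProbabilityMeasure q]
    (σ : ℝ) (l : Ω → ℝ) (hac : q ≪ p)
    (hsg : IsSubGaussian p σ l) (hlq : Integrable l q) :
    ENNReal.ofReal |∫ x, l x ∂q - ∫ x, l x ∂p| ≤
      ENNReal.ofReal σ * (2 * klDiv q p) ^ (1/2 : ℝ) := by
  rcases hsg.1.eq_or_lt with h0 | hσ
  · subst h0
    have h := hac.ae_le (subGaussian_zero_ae p l hsg)
    have : ∫ x, l x ∂q = ∫ x, l x ∂p := by
      rw [integral_congr_ae h]; simp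
    simp [this]
  by_cases hi : Integrable (llr q p) q
  swap
  · have : klDiv q p = ⊤ := by simp [klDiv, hi]
    rw [this, ENNReal.mul_top (by norm_num), ENNReal.top_rpow_of_pos (by norm_num),
      ENNReal.mul_top (by simpa using hσ)]
    exact le_top
  have hk : klDiv q p = ENNReal.ofReal (∫ x, llr q p x ∂q) := by simp [klDiv, hi, hac]
  have key : ∀ lam : ℝ, lam * (∫ x, l x ∂q - ∫ x, l x ∂p) ≤
      ∫ x, llr q p x ∂q + lam ^ 2 * σ ^ 2 / 2 := by
    intro lam
    obtain ⟨h1, h2⟩ := hsg.2.2 lam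
    have h3 := dv_bound p q _ hac
      ((hlq.sub (integrable_const (∫ y, l y ∂p))).const_mul lam) h1 hi
    simp only [Pi.sub_apply] at h3
    rw [integral_const_mul, integral_sub hlq (integrable_const _)] at h3
    simp only [integral_const, probReal_univ, one_smul] at h3
    linarith
  rw [hk]
  set K := ∫ x, llr q p x ∂q
  set d := ∫ x, l x ∂q - ∫ x, l x ∂p
  have hK : 0 ≤ K := by simpa using key 0
  have h2 : ENNReal.ofReal σ * (2 * ENNReal.ofReal K) ^ (1/2 : ℝ)
      = ENNReal.ofReal (σ * √(2 * K)) := by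
    rw [ENNReal.ofReal_mul hσ.le, Real.sqrt_eq_rpow,
      ← ENNReal.ofReal_rpow_of_nonneg (by positivity) (by norm_num),
      ENNReal.ofReal_mul (by norm_num)]
    simp
  rw [h2]
  apply ENNReal.ofReal_le_ofReal
  have h3 := key (d / σ ^ 2)
  have h4 : d ^ 2 ≤ σ ^ 2 * (2 * K) := by
    have e1 : d / σ ^ 2 * d = d ^ 2 / σ ^ 2 := by ring
    have e2 : (d / σ ^ 2) ^ 2 * σ ^ 2 / 2 = d ^ 2 / σ ^ 2 / 2 := by field_simp
    rw [e1, e2] at h3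
    have : d ^ 2 / σ ^ 2 ≤ 2 * K := by linarith
    rw [div_le_iff₀ (by positivity)] at this
    linarith
  apply abs_le_of_sq_le_sq _ (by positivity)
  rw [mul_pow, Real.sq_sqrt (by positivity)]
  exact h4
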